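/- arXiv:1407.5418 — 3 statements merged into one kernel-verified Lean document; each statement's English description precedes it below -/
import Mathlib

section
/- Let J : ℝ^n → ℝ and H : ℝ^n → ℝ^r be continuously differentiable, A ∈ ℝ^{q×n}, and let {z_k} ⊂ ℝ^n, {λ_k} ⊂ ℝ^q, {μ̃_k} ⊂ ℝ^r, {d_k} ⊂ ℝ^n satisfy ∇J(z_k) + ∇H(z_k)ᵀμ̃_k + Aᵀλ_k = −d_k for all k, z_k → z', λ_k → λ', and d_k → 0. Suppose the gradients ∇H₁(z'), …, ∇H_r(z') are linearly independent (i.e., the Jacobian ∇H(z') ∈ ℝ^{r×n} has full row rank). Then μ̃_k converges to μ̃' := (∇H(z')∇H(z')ᵀ)^{-1} ∇H(z') (−∇J(z') − Aᵀλ'), and consequently ∇J(z') + ∇H(z')ᵀμ̃' + Aᵀλ' = 0. -/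
open Matrix Filter
open scoped Topology

/-- Reinterpret a plain vector in `Fin n → ℝ` as an element of Euclidean space. -/
noncomputable def toEuc {n : ℕ} (v : Fin n → ℝ) : EuclideanSpace ℝ (Fin n) :=
  (WithLp.equiv 2 (Fin n → ℝ)).symm v

/-- The gradient of a continuously differentiable function is continuous. -/
theorem ContDiff.continuous_gradient {F : Type*} [NormedAddCommGroup F] [InnerProductSpace ℝ F]
    [CompleteSpace F] {f : F → ℝ} (hf : ContDiff ℝ 1 f) : Continuous (gradient f) :=
  (InnerProductSpace.toDual ℝ F).symm.continuous.comp (hf.continuous_fderiv one_ne_zero)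

/-- The Gram matrix of linearly independent rows is invertible. -/
theorem Matrix.isUnit_det_mul_transpose_self_of_linearIndependent {m n : Type*} [Fintype m]
    [Fintype n] [DecidableEq m] {G : Matrix m n ℝ} (hG : LinearIndependent ℝ G.row) :
    IsUnit (G * Gᵀ).det := by
  rw [← Matrix.isUnit_iff_isUnit_det, ← conjTranspose_eq_transpose_of_trivial]
  exact (Matrix.PosDef.mul_conjTranspose_self G (Matrix.vecMul_injective_iff.2 hG)).isUnit

/-- If `G k → G₀` with invertible Gram matrix `G₀ G₀ᵀ` and `(G k)ᵀ x k → b`, then `x k` converges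
to the least-squares solution of `G₀ᵀ x = b`. -/
theorem Matrix.tendsto_of_tendsto_transpose_mulVec {ι m n : Type*} [Fintype m] [Fintype n]
    [DecidableEq m] {l : Filter ι} {G : ι → Matrix m n ℝ} {G₀ : Matrix m n ℝ}
    {x : ι → m → ℝ} {b : n → ℝ} (hG : Tendsto G l (𝓝 G₀)) (hG₀ : IsUnit (G₀ * G₀ᵀ).det)
    (hx : Tendsto (fun k => (G k)ᵀ *ᵥ x k) l (𝓝 b)) :
    Tendsto x l (𝓝 ((G₀ * G₀ᵀ)⁻¹ *ᵥ (G₀ *ᵥ b))) := by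
  have hgram : Tendsto (fun k => G k * (G k)ᵀ) l (𝓝 (G₀ * G₀ᵀ)) :=
    ((continuous_id.matrix_mul continuous_id.matrix_transpose).tendsto G₀).comp hG
  have hinv : Tendsto (fun k => (G k * (G k)ᵀ)⁻¹) l (𝓝 (G₀ * G₀ᵀ)⁻¹) := by
    refine (continuousAt_matrix_inv _ ?_).tendsto.comp hgram
    simpa using NormedRing.inverse_continuousAt hG₀.unit
  have hmulVec : Continuous fun p : Matrix m m ℝ × Matrix m n ℝ × (n → ℝ) =>
      p.1 *ᵥ (p.2.1 *ᵥ p.2.2) := by fun_prop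
  have hdet : ∀ᶠ k in l, (G k * (G k)ᵀ).det ≠ 0 :=
    ((continuous_id.matrix_det.tendsto _).comp hgram).eventually_ne hG₀.ne_zero
  refine ((hmulVec.tendsto _).comp (hinv.prodMk_nhds (hG.prodMk_nhds hx))).congr' ?_
  filter_upwards [hdet] with k hk
  simp [Matrix.mulVec_mulVec, Matrix.nonsing_inv_mul _ hk.isUnit, Matrix.mul_assoc _ (G k)]

/-- **Convergence of the multiplier estimates.** If the inexact stationarity identities
`∇J(z_k) + ∇H(z_k)ᵀ μ̃_k + Aᵀ λ_k = -d_k` hold, `z_k → z'`, `λ_k → λ'`, `d_k → 0`, and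
the Jacobian `∇H(z')` has full row rank, then `μ̃_k` converges to
`μ̃' = (∇H(z')∇H(z')ᵀ)⁻¹ ∇H(z') (-∇J(z') - Aᵀλ')`, and the limit satisfies the
stationarity equation `∇J(z') + ∇H(z')ᵀ μ̃' + Aᵀ λ' = 0`. -/
theorem tilde_mu_converges {n r q : ℕ}
    (J : EuclideanSpace ℝ (Fin n) → ℝ)
    (H : EuclideanSpace ℝ (Fin n) → EuclideanSpace ℝ (Fin r))
    (hJ : ContDiff ℝ 1 J) (hH : ContDiff ℝ 1 H)
    (A : Matrix (Fin q) (Fin n) ℝ)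
    (zk : ℕ → EuclideanSpace ℝ (Fin n)) (lamk : ℕ → Fin q → ℝ)
    (μtk : ℕ → EuclideanSpace ℝ (Fin r)) (dk : ℕ → EuclideanSpace ℝ (Fin n))
    (hstat : ∀ k, gradient J (zk k)
        + ∑ j, μtk k j • gradient (fun w => H w j) (zk k)
        + toEuc (Aᵀ.mulVec (lamk k)) = -dk k)
    (z' : EuclideanSpace ℝ (Fin n)) (lam' : Fin q → ℝ)
    (hz : Tendsto zk atTop (𝓝 z')) (hlam : Tendsto lamk atTop (𝓝 lam'))
    (hd : Tendsto dk atTop (𝓝 0))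
    -- full row rank of the Jacobian `∇H(z')`, whose rows are the gradients `∇H_j(z')`
    (hreg : LinearIndependent ℝ (fun j : Fin r => gradient (fun w => H w j) z'))
    -- the Jacobian matrix `∇H(z')` and the limit multiplier `μ̃'`
    (Gm : Matrix (Fin r) (Fin n) ℝ)
    (hGm : Gm = Matrix.of fun (j : Fin r) (i : Fin n) => gradient (fun w => H w j) z' i)
    (μt' : EuclideanSpace ℝ (Fin r))
    (hμt' : μt' = (WithLp.equiv 2 (Fin r → ℝ)).symm
        ((Gm * Gmᵀ)⁻¹.mulVec
          (Gm.mulVec (-gradient J z' - toEuc (Aᵀ.mulVec lam'))))) :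
    Tendsto μtk atTop (𝓝 μt') ∧
      gradient J z' + ∑ j, μt' j • gradient (fun w => H w j) z'
        + toEuc (Aᵀ.mulVec lam') = 0 := by
  have hgrad (j : Fin r) : Continuous (gradient fun w => H w j) :=
    ContDiff.continuous_gradient (by fun_prop)
  have hA : Continuous fun v : Fin q → ℝ => toEuc (Aᵀ *ᵥ v) := by
    unfold toEuc
    exact (PiLp.continuous_toLp 2 _).comp (by fun_prop)
  have hb : Tendsto (fun k => ∑ j, μtk k j • gradient (fun w => H w j) (zk k)) atTop
      (𝓝 (-gradient J z' - toEuc (Aᵀ *ᵥ lam'))) := by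
    have h := (hd.neg.sub ((hJ.continuous_gradient.tendsto z').comp hz)).sub
      ((hA.tendsto lam').comp hlam)
    rw [neg_zero, zero_sub] at h
    refine h.congr fun k => ?_
    simp only [Function.comp_apply, ← hstat k]
    abel
  have hμ : Tendsto μtk atTop (𝓝 μt') := by
    have hG : Tendsto (fun k => Matrix.of fun (j : Fin r) (i : Fin n) =>
        gradient (fun w => H w j) (zk k) i) atTop (𝓝 Gm) := by
      rw [hGm]
      refine tendsto_pi_nhds.2 fun j => tendsto_pi_nhds.2 fun i => ?_
      exact (((EuclideanSpace.proj i).continuous.comp (hgrad j)).tendsto z').comp hz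
    have hdet : IsUnit (Gm * Gmᵀ).det := by
      refine Matrix.isUnit_det_mul_transpose_self_of_linearIndependent ?_
      rw [hGm]
      exact hreg.map' (WithLp.linearEquiv 2 ℝ (Fin n → ℝ)).toLinearMap (LinearEquiv.ker _)
    have h := Matrix.tendsto_of_tendsto_transpose_mulVec (x := fun k => (μtk k).ofLp)
      (b := (-gradient J z' - toEuc (Aᵀ *ᵥ lam')).ofLp) hG hdet <| by
        refine (((PiLp.continuous_ofLp 2 _).tendsto _).comp hb).congr fun k => ?_
        ext i
        simp [Matrix.mulVec, dotProduct, mul_comm]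
    rw [hμt']
    exact ((PiLp.continuous_toLp 2 _).tendsto _).comp h
  refine ⟨hμ, ?_⟩
  have hsum : Tendsto (fun k => ∑ j, μtk k j • gradient (fun w => H w j) (zk k)) atTop
      (𝓝 (∑ j, μt' j • gradient (fun w => H w j) z')) :=
    tendsto_finsetSum _ fun j _ =>
      (((EuclideanSpace.proj (𝕜 := ℝ) j).continuous.tendsto μt').comp hμ).smul
        (((hgrad j).tendsto z').comp hz)
  rw [tendsto_nhds_unique hsum hb]
  abel
end

section
/- Let Z ⊆ ℝ^n be a convex compact set, let L : ℝ^n → ℝ be twice continuously differentiable on Z with ‖∇²L(x)‖₂ ≤ C for all x ∈ Z, let α > 0, and let B ∈ ℝ^{n×n} be a symmetric matrix such that B − C·I_n is positive definite. Let z ∈ Z and let z⁺ be a minimiser over Z of the quadratic model w ↦ ∇L(z)ᵀ(w − z) + (1/2)(w − z)ᵀ(B + α·I_n)(w − z). Then L(z⁺) + (α/2)‖z⁺ − z‖₂² ≤ L(z). -/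
open Matrix
open scoped RealInnerProductSpace

/-- **Descent lemma**: a function whose second derivative is bounded by `C` on a convex set is
bounded above there by its first-order expansion plus `C / 2` times the squared distance. -/
theorem Convex.le_add_fderiv_add_sq_of_norm_fderiv_fderiv_le
    {E : Type*} [NormedAddCommGroup E] [NormedSpace ℝ E] {s : Set E} (hs : Convex ℝ s)
    {f : E → ℝ} (hf : Differentiable ℝ f) (hf' : Differentiable ℝ (fderiv ℝ f)) {C : ℝ}
    (hC : ∀ x ∈ s, ‖fderiv ℝ (fderiv ℝ f) x‖ ≤ C) {x y : E} (hx : x ∈ s) (hy : y ∈ s) :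
    f y ≤ f x + fderiv ℝ f x (y - x) + C / 2 * ‖y - x‖ ^ 2 := by
  set d := y - x with hd
  have hderiv (t : ℝ) : HasDerivAt
      (fun t : ℝ => f (x + t • d) - t * fderiv ℝ f x d - C / 2 * ‖d‖ ^ 2 * t ^ 2)
      (fderiv ℝ f (x + t • d) d - fderiv ℝ f x d - C * ‖d‖ ^ 2 * t) t := by
    have hline : HasDerivAt (fun t : ℝ => x + t • d) d t := by
      simpa using ((hasDerivAt_id t).smul_const d).const_add x
    have hcomp := (hf (x + t • d)).hasFDerivAt.comp_hasDerivAt t hline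
    have hlin := (hasDerivAt_id t).mul_const (fderiv ℝ f x d)
    have hquad := ((hasDerivAt_id t).pow 2).const_mul (C / 2 * ‖d‖ ^ 2)
    refine ((hcomp.sub hlin).sub hquad).congr_deriv ?_
    simp only [id, one_mul, Nat.cast_ofNat]
    ring
  have hanti : AntitoneOn
      (fun t : ℝ => f (x + t • d) - t * fderiv ℝ f x d - C / 2 * ‖d‖ ^ 2 * t ^ 2)
      (Set.Icc 0 1) := by
    refine antitoneOn_of_deriv_nonpos (convex_Icc 0 1)
      (fun t _ => (hderiv t).continuousAt.continuousWithinAt)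
      (fun t _ => (hderiv t).differentiableAt.differentiableWithinAt) fun t ht => ?_
    rw [interior_Icc] at ht
    rw [(hderiv t).deriv]
    have hmem : x + t • d ∈ s := hs.add_smul_sub_mem hx hy ⟨ht.1.le, ht.2.le⟩
    have hlip : ‖fderiv ℝ f (x + t • d) - fderiv ℝ f x‖ ≤ C * (t * ‖d‖) := by
      simpa [norm_smul, abs_of_pos ht.1] using
        hs.norm_image_sub_le_of_norm_fderiv_le (fun z _ => hf' z) hC hx hmem
    have hle : fderiv ℝ f (x + t • d) d - fderiv ℝ f x d ≤ C * (t * ‖d‖) * ‖d‖ :=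
      (Real.le_norm_self _).trans
        ((fderiv ℝ f (x + t • d) - fderiv ℝ f x).le_of_opNorm_le hlip d)
    linarith
  have h := hanti (Set.left_mem_Icc.2 zero_le_one) (Set.right_mem_Icc.2 zero_le_one) zero_le_one
  have hend : x + d = y := by simp [hd]
  simp only [one_smul, zero_smul, add_zero, hend] at h
  linarith

/-- **Sufficient decrease for one proximal regularised block update.** If `L` is `C²`
with Hessian operator norm bounded by `C` on the convex compact set `Z`, `B` is symmetric
with `B - C·I` positive definite, `α > 0`, and `z⁺` minimises over `Z` the quadratic
model `w ↦ ∇L(z)ᵀ(w - z) + (1/2)(w - z)ᵀ(B + αI)(w - z)`, then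
`L(z⁺) + (α/2)‖z⁺ - z‖² ≤ L(z)`. -/
theorem sufficient_decrease {n : ℕ} (Z : Set (EuclideanSpace ℝ (Fin n)))
    (hZconv : Convex ℝ Z) (hZcomp : IsCompact Z)
    (L : EuclideanSpace ℝ (Fin n) → ℝ) (hL : ContDiff ℝ 2 L)
    (C : ℝ) (hC : ∀ x ∈ Z, ‖fderiv ℝ (fderiv ℝ L) x‖ ≤ C)
    (α : ℝ) (hα : 0 < α)
    (B : Matrix (Fin n) (Fin n) ℝ) (hBsymm : B.IsSymm)
    (hBpd : (B - C • (1 : Matrix (Fin n) (Fin n) ℝ)).PosDef)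
    (z : EuclideanSpace ℝ (Fin n)) (hz : z ∈ Z)
    (zplus : EuclideanSpace ℝ (Fin n)) (hzplus : zplus ∈ Z)
    (hmin : ∀ w ∈ Z,
      ⟪gradient L z, zplus - z⟫
          + 1 / 2 * ((zplus - z) ⬝ᵥ (B + α • (1 : Matrix (Fin n) (Fin n) ℝ)).mulVec (zplus - z))
        ≤ ⟪gradient L z, w - z⟫
          + 1 / 2 * ((w - z) ⬝ᵥ (B + α • (1 : Matrix (Fin n) (Fin n) ℝ)).mulVec (w - z))) :
    L zplus + α / 2 * ‖zplus - z‖ ^ 2 ≤ L z := by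
  have htaylor := hZconv.le_add_fderiv_add_sq_of_norm_fderiv_fderiv_le
    (hL.differentiable (by norm_num))
    ((hL.fderiv_right (m := 1) (by norm_num)).differentiable (by norm_num)) hC hz hzplus
  have hmodel := hmin z hz
  have hcurv := hBpd.posSemidef.dotProduct_mulVec_nonneg (zplus - z).ofLp
  have hnorm : (zplus - z).ofLp ⬝ᵥ (zplus - z).ofLp = ‖zplus - z‖ ^ 2 := by
    rw [EuclideanSpace.real_norm_sq_eq]
    simp [dotProduct, sq]
  have hgrad : ⟪gradient L z, zplus - z⟫ = fderiv ℝ L z (zplus - z) := by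
    simp [gradient]
  rw [hgrad] at hmodel
  simp only [← WithLp.ofLp_sub, star_trivial, sub_mulVec, add_mulVec, smul_mulVec, one_mulVec, dotProduct_sub,
    dotProduct_add, dotProduct_smul, smul_eq_mul, hnorm, sub_self, inner_zero_right,
    WithLp.ofLp_zero, zero_dotProduct, mul_zero, add_zero] at hmodel hcurv
  linarith
end

section
/- Let Z ⊆ ℝ^n be a convex compact set, let L : ℝ^n → ℝ be twice continuously differentiable on Z with ‖∇²L(x)‖₂ ≤ C for all x ∈ Z, let α > 0, and let B ∈ ℝ^{n×n} be a symmetric matrix such that both B − C·I_n and 2C·I_n − B are positive definite. Let z ∈ Z and let z⁺ be a minimiser over Z of the quadratic model w ↦ ∇L(z)ᵀ(w − z) + (1/2)(w − z)ᵀ(B + α·I_n)(w − z). Then there exists w ∈ N_Z(z⁺) such that ‖∇L(z⁺) + w‖₂ ≤ (3C + α)‖z⁺ − z‖₂. -/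
open Matrix
open scoped RealInnerProductSpace

/-- The normal cone to a convex set `Ω` at a point `x̄`. -/
def normalCone {n : ℕ} (Ω : Set (EuclideanSpace ℝ (Fin n)))
    (xbar : EuclideanSpace ℝ (Fin n)) : Set (EuclideanSpace ℝ (Fin n)) :=
  {v | ∀ x ∈ Ω, ⟪v, x - xbar⟫ ≤ (0 : ℝ)}

section InnerProductSpace

variable {E : Type*} [NormedAddCommGroup E] [InnerProductSpace ℝ E]

/-- A symmetric operator whose quadratic form lies between `0` and `K‖x‖²` has norm at most `K`. -/
theorem norm_apply_le_of_inner_le {T : E →ₗ[ℝ] E} (hT : T.IsSymmetric) {K : ℝ} (hK : 0 < K)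
    (h₀ : ∀ x, 0 ≤ ⟪T x, x⟫) (h₁ : ∀ x, ⟪T x, x⟫ ≤ K * ‖x‖ ^ 2) (x : E) :
    ‖T x‖ ≤ K * ‖x‖ := by
  have h := h₀ (K • x - T x)
  have hsymm : ⟪T (T x), x⟫ = ‖T x‖ ^ 2 := by rw [hT, real_inner_self_eq_norm_sq]
  simp only [map_sub, map_smul, inner_sub_left, inner_sub_right, real_inner_smul_left,
    real_inner_smul_right, real_inner_self_eq_norm_sq, hsymm] at h
  have hsq : K * ‖T x‖ ^ 2 ≤ K * (K * ‖x‖) ^ 2 := by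
    nlinarith [h₁ (T x), mul_le_mul_of_nonneg_left (h₁ x) (sq_nonneg K)]
  exact le_of_sq_le_sq (le_of_mul_le_mul_left hsq hK) (by positivity)

/-- First-order optimality condition for a quadratic model minimised over a convex set. -/
theorem inner_add_apply_nonneg_of_isMinOn {Z : Set E} (hZ : Convex ℝ Z) {T : E →ₗ[ℝ] E}
    (hT : T.IsSymmetric) {g z y : E} (hy : y ∈ Z)
    (hmin : ∀ w ∈ Z, ⟪g, y - z⟫ + 1 / 2 * ⟪T (y - z), y - z⟫ ≤
      ⟪g, w - z⟫ + 1 / 2 * ⟪T (w - z), w - z⟫) {x : E} (hx : x ∈ Z) :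
    0 ≤ ⟪g + T (y - z), x - y⟫ := by
  have hstep : ∀ t ∈ Set.Ioc (0 : ℝ) 1,
      0 ≤ ⟪g + T (y - z), x - y⟫ + t * (1 / 2 * ⟪T (x - y), x - y⟫) := by
    rintro t ⟨ht₀, ht₁⟩
    have h := hmin _ (hZ.add_smul_sub_mem hy hx ⟨ht₀.le, ht₁⟩)
    have hsymm : ⟪T (x - y), y - z⟫ = ⟪T (y - z), x - y⟫ := by rw [hT, real_inner_comm]
    rw [add_sub_right_comm] at h
    generalize y - z = d at *
    generalize x - y = u at *
    simp only [map_add, map_smul, inner_add_left, inner_add_right, real_inner_smul_left,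
      real_inner_smul_right, hsymm] at h ⊢
    refine nonneg_of_mul_nonneg_right (a := t) ?_ ht₀
    linarith
  have hlim : Filter.Tendsto
      (fun t : ℝ => ⟪g + T (y - z), x - y⟫ + t * (1 / 2 * ⟪T (x - y), x - y⟫))
      (nhdsWithin 0 (Set.Ioi 0)) (nhds ⟪g + T (y - z), x - y⟫) := by
    refine Filter.Tendsto.mono_left ?_ nhdsWithin_le_nhds
    exact Continuous.tendsto' (by fun_prop) _ _ (by simp)
  exact ge_of_tendsto hlim
    (Filter.eventually_of_mem (Ioc_mem_nhdsGT one_pos) hstep)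

/-- A Hessian bound on a convex set makes the gradient Lipschitz there. -/
theorem norm_gradient_sub_le_of_norm_fderiv_fderiv_le [CompleteSpace E] {Z : Set E}
    (hZ : Convex ℝ Z) {L : E → ℝ} (hL : ContDiff ℝ 2 L) {C : ℝ}
    (hC : ∀ x ∈ Z, ‖fderiv ℝ (fderiv ℝ L) x‖ ≤ C) {x y : E} (hx : x ∈ Z) (hy : y ∈ Z) :
    ‖gradient L y - gradient L x‖ ≤ C * ‖y - x‖ := by
  have hd : Differentiable ℝ (fderiv ℝ L) :=
    (hL.fderiv_right (m := 1) (by norm_num)).differentiable one_ne_zero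
  simpa only [gradient, ← map_sub, LinearIsometryEquiv.norm_map] using
    hZ.norm_image_sub_le_of_norm_fderiv_le (fun x _ => hd x) hC hx hy

end InnerProductSpace

/-- **Relative error condition for one proximal regularised block update.** If `L` is
`C²` with Hessian operator norm bounded by `C` on the convex compact set `Z`, `B` is
symmetric with both `B - C·I` and `2C·I - B` positive definite, `α > 0`, and `z⁺`
minimises over `Z` the quadratic model
`w ↦ ∇L(z)ᵀ(w - z) + (1/2)(w - z)ᵀ(B + αI)(w - z)`, then there exists `w` in the normal
cone `N_Z(z⁺)` with `‖∇L(z⁺) + w‖ ≤ (3C + α)‖z⁺ - z‖`. -/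
theorem relative_error_condition {n : ℕ} (Z : Set (EuclideanSpace ℝ (Fin n)))
    (hZconv : Convex ℝ Z) (hZcomp : IsCompact Z)
    (L : EuclideanSpace ℝ (Fin n) → ℝ) (hL : ContDiff ℝ 2 L)
    (C : ℝ) (hC : ∀ x ∈ Z, ‖fderiv ℝ (fderiv ℝ L) x‖ ≤ C)
    (α : ℝ) (hα : 0 < α)
    (B : Matrix (Fin n) (Fin n) ℝ) (hBsymm : B.IsSymm)
    (hBpd : (B - C • (1 : Matrix (Fin n) (Fin n) ℝ)).PosDef)
    (hBpd' : ((2 * C) • (1 : Matrix (Fin n) (Fin n) ℝ) - B).PosDef)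
    (z : EuclideanSpace ℝ (Fin n)) (hz : z ∈ Z)
    (zplus : EuclideanSpace ℝ (Fin n)) (hzplus : zplus ∈ Z)
    (hmin : ∀ w ∈ Z,
      ⟪gradient L z, zplus - z⟫
          + 1 / 2 * ((zplus - z) ⬝ᵥ (B + α • (1 : Matrix (Fin n) (Fin n) ℝ)).mulVec (zplus - z))
        ≤ ⟪gradient L z, w - z⟫
          + 1 / 2 * ((w - z) ⬝ᵥ (B + α • (1 : Matrix (Fin n) (Fin n) ℝ)).mulVec (w - z))) :
    ∃ w ∈ normalCone Z zplus, ‖gradient L zplus + w‖ ≤ (3 * C + α) * ‖zplus - z‖ := by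
  have hC₀ : 0 ≤ C := (ContinuousLinearMap.opNorm_nonneg _).trans (hC z hz)
  let T := Matrix.toEuclideanLin (B + α • (1 : Matrix (Fin n) (Fin n) ℝ))
  have hquad (x : EuclideanSpace ℝ (Fin n)) :
      x ⬝ᵥ (B + α • (1 : Matrix (Fin n) (Fin n) ℝ)).mulVec x = ⟪T x, x⟫ := by
    simp only [T, EuclideanSpace.inner_eq_star_dotProduct, Matrix.toLpLin_apply, star_trivial]
  have hnorm (x : EuclideanSpace ℝ (Fin n)) : x.ofLp ⬝ᵥ x.ofLp = ‖x‖ ^ 2 := by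
    rw [EuclideanSpace.real_norm_sq_eq]
    simp only [dotProduct, sq]
  have hT : T.IsSymmetric := by
    refine Matrix.isSymmetric_toEuclideanLin_iff.2 ?_
    rw [Matrix.IsHermitian, Matrix.conjTranspose_eq_transpose_of_trivial]
    simp [hBsymm.eq]
  have hlow (x : EuclideanSpace ℝ (Fin n)) : 0 ≤ ⟪T x, x⟫ := by
    have h := hBpd.posSemidef.dotProduct_mulVec_nonneg x.ofLp
    simp only [star_trivial, sub_mulVec, smul_mulVec, one_mulVec, dotProduct_sub,
      dotProduct_smul, smul_eq_mul, hnorm] at h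
    simp only [← hquad, add_mulVec, smul_mulVec, one_mulVec, dotProduct_add,
      dotProduct_smul, smul_eq_mul, hnorm]
    have : 0 ≤ (C + α) * ‖x‖ ^ 2 := by positivity
    linarith
  have hupp (x : EuclideanSpace ℝ (Fin n)) : ⟪T x, x⟫ ≤ (2 * C + α) * ‖x‖ ^ 2 := by
    have h := hBpd'.posSemidef.dotProduct_mulVec_nonneg x.ofLp
    simp only [star_trivial, sub_mulVec, smul_mulVec, one_mulVec, dotProduct_sub,
      dotProduct_smul, smul_eq_mul, hnorm] at h
    simp only [← hquad, add_mulVec, smul_mulVec, one_mulVec, dotProduct_add,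
      dotProduct_smul, smul_eq_mul, hnorm]
    linarith
  simp only [← WithLp.ofLp_sub, hquad] at hmin
  refine ⟨-(gradient L z + T (zplus - z)), fun x hx => ?_, ?_⟩
  · rw [inner_neg_left]
    exact neg_nonpos.2 (inner_add_apply_nonneg_of_isMinOn hZconv hT hzplus hmin hx)
  · calc ‖gradient L zplus + -(gradient L z + T (zplus - z))‖
        = ‖(gradient L zplus - gradient L z) - T (zplus - z)‖ := by congr 1; abel
      _ ≤ ‖gradient L zplus - gradient L z‖ + ‖T (zplus - z)‖ := norm_sub_le _ _
      _ ≤ C * ‖zplus - z‖ + (2 * C + α) * ‖zplus - z‖ :=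
        add_le_add (norm_gradient_sub_le_of_norm_fderiv_fderiv_le hZconv hL hC hz hzplus)
          (norm_apply_le_of_inner_le hT (by positivity) hlow hupp _)
      _ = (3 * C + α) * ‖zplus - z‖ := by ring
end
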